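/- Suppose S = {0,1}^K, τ̂(s) = τ0 + Σ_{k=1}^K s_k δ_k, c(s) = c0 + Σ_{k=1}^K s_k Δc_k, with τ0 > c0 > 0 and c(s) ≥ 0 for all s ∈ S. Define effective shifts e_k = Δc_k − δ_k, let 𝒦⁺ = {k : e_k > 0} with K⁺ = |𝒦⁺|, order e_{π(1)} ≥ ⋯ ≥ e_{π(K⁺)} > 0, and set E_r = Σ_{j=1}^r e_{π(j)}. If m = min{r ∈ {1,…,K⁺} : E_r ≥ τ0 − c0} exists and the configuration s_g activating exactly {π(1),…,π(m)} satisfies τ̂(s_g) ≥ −c(s_g), then s_g is null-compatible and ‖s_g‖₀ = MSP(S, N(S)) = m. If no such m exists, then MSP(S, N(S)) = ∞. -/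

import Mathlib

/-- Minimum specification perturbation: the least Hamming weight (cardinality)
of a feasible specification, or `⊤` if the feasible set is empty. -/
noncomputable def MSP {K : ℕ} (F : Set (Finset (Fin K))) : ℕ∞ :=
  ⨅ s ∈ F, (s.card : ℕ∞)

/-- Greedy prefix sum of effective shifts: `E r = ∑_{j=1}^r e_{π(j)}`
(with `π` zero-indexed). -/
def Esum {K : ℕ} (e : Fin K → ℝ) (π : ℕ → Fin K) (r : ℕ) : ℝ :=
  ∑ j ∈ Finset.range r, e (π j)

/-- Among finite subsets of `{0, …, n - 1}` of given size, the initial segment maximizes the sum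
of a function that is antitone there. -/
theorem sum_le_sum_range_card_of_antitone {f : ℕ → ℝ} {n : ℕ}
    (hf : ∀ i j, i ≤ j → j < n → f j ≤ f i) {J : Finset ℕ} (hJ : J ⊆ Finset.range n) :
    ∑ j ∈ J, f j ≤ ∑ j ∈ Finset.range J.card, f j := by
  induction n generalizing J with
  | zero =>
    obtain rfl : J = ∅ := by simpa using hJ
    simp
  | succ n ih =>
    have hErase : J.erase n ⊆ Finset.range n := by
      intro j hj
      have hlt := Finset.mem_range.1 (hJ (Finset.mem_of_mem_erase hj))
      have hne := Finset.ne_of_mem_erase hj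
      exact Finset.mem_range.2 (by omega)
    have hsum := ih (fun i j hij hj => hf i j hij (by omega)) hErase
    by_cases hn : n ∈ J
    · have hcard : (J.erase n).card ≤ n := by simpa using Finset.card_le_card hErase
      rw [← Finset.sum_erase_add J f hn, ← Finset.card_erase_add_one hn, Finset.sum_range_succ]
      exact add_le_add hsum (hf _ _ hcard n.lt_succ_self)
    · rwa [Finset.erase_eq_of_notMem hn] at hsum

/-- The total effective shift of a configuration is at most some greedy prefix sum which is
no longer than the configuration. -/
theorem exists_sum_le_Esum {K : ℕ} {e : Fin K → ℝ} {n : ℕ} {π : ℕ → Fin K}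
    (hinj : ∀ i j, i < n → j < n → π i = π j → i = j)
    (hsurj : ∀ k : Fin K, 0 < e k → ∃ j, j < n ∧ π j = k)
    (hsort : ∀ i j, i ≤ j → j < n → e (π j) ≤ e (π i)) (s : Finset (Fin K)) :
    ∃ r, r ≤ s.card ∧ r ≤ n ∧ ∑ k ∈ s, e k ≤ Esum e π r := by
  set J := (Finset.range n).filter (fun j => π j ∈ s)
  have hJn : J ⊆ Finset.range n := Finset.filter_subset _ _
  have hJinj : Set.InjOn π J := fun i hi j hj h =>
    hinj i j (Finset.mem_range.1 (hJn hi)) (Finset.mem_range.1 (hJn hj)) h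
  have hJs : J.image π ⊆ s := by
    intro k hk
    obtain ⟨j, hj, rfl⟩ := Finset.mem_image.1 hk
    exact (Finset.mem_filter.1 hj).2
  refine ⟨J.card, ?_, by simpa using Finset.card_le_card hJn, ?_⟩
  · rw [← Finset.card_image_of_injOn hJinj]
    exact Finset.card_le_card hJs
  · have hrest : ∑ k ∈ s \ J.image π, e k ≤ 0 := by
      refine Finset.sum_nonpos fun k hk => ?_
      obtain ⟨hks, hkJ⟩ := Finset.mem_sdiff.1 hk
      by_contra! hpos
      obtain ⟨j, hj, rfl⟩ := hsurj k hpos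
      exact hkJ (Finset.mem_image_of_mem π
        (Finset.mem_filter.2 ⟨Finset.mem_range.2 hj, hks⟩))
    calc ∑ k ∈ s, e k = ∑ k ∈ s \ J.image π, e k + ∑ k ∈ J.image π, e k :=
          (Finset.sum_sdiff hJs).symm
      _ ≤ ∑ k ∈ J.image π, e k := by linarith
      _ = ∑ j ∈ J, e (π j) := Finset.sum_image hJinj
      _ ≤ Esum e π J.card := sum_le_sum_range_card_of_antitone hsort hJn

/-- Variable-width greedy exactness: in the variable-width additive model
`τ̂(s) = τ0 + ∑_k s_k δ_k`, `c(s) = c0 + ∑_k s_k Δc_k` with `τ0 > c0 > 0` and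
`c(s) ≥ 0`, effective shifts `e_k = Δc_k - δ_k`, positive-shift axes
`𝒦⁺ = {k : e_k > 0}` enumerated by `π` in decreasing order: if `m` is the
smallest index in `{1,…,K⁺}` with `E_m ≥ τ0 - c0` and the greedy configuration
`s_g` activating exactly `{π(1),…,π(m)}` satisfies the lower-bound condition
`τ̂(s_g) ≥ -c(s_g)`, then `s_g` is null-compatible and
`‖s_g‖₀ = MSP(S, N(S)) = m`; if no such `m` exists, then `MSP(S,N(S)) = ∞`. -/
theorem variable_width_greedy_exactness {K : ℕ} (τ0 c0 : ℝ) (δ Δc : Fin K → ℝ)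
    (hc0 : 0 < c0) (hτ : c0 < τ0)
    (hcs : ∀ s : Finset (Fin K), 0 ≤ c0 + ∑ k ∈ s, Δc k)
    (e : Fin K → ℝ) (he : ∀ k, e k = Δc k - δ k)
    (Kp : ℕ) (hKp : Kp = (Finset.univ.filter (fun k => 0 < e k)).card)
    (π : ℕ → Fin K)
    (hπinj : ∀ i j, i < Kp → j < Kp → π i = π j → i = j)
    (hπmem : ∀ j, j < Kp → 0 < e (π j))
    (hπsurj : ∀ k : Fin K, 0 < e k → ∃ j, j < Kp ∧ π j = k)
    (hsort : ∀ i j, i ≤ j → j < Kp → e (π j) ≤ e (π i)) :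
    (∀ m, 1 ≤ m → m ≤ Kp → τ0 - c0 ≤ Esum e π m →
      (∀ r, 1 ≤ r → r < m → Esum e π r < τ0 - c0) →
      -(c0 + ∑ k ∈ Finset.image π (Finset.range m), Δc k) ≤
          τ0 + ∑ k ∈ Finset.image π (Finset.range m), δ k →
      (Finset.image π (Finset.range m) ∈
          {s : Finset (Fin K) |
            -(c0 + ∑ k ∈ s, Δc k) ≤ τ0 + ∑ k ∈ s, δ k ∧
              τ0 + ∑ k ∈ s, δ k ≤ c0 + ∑ k ∈ s, Δc k} ∧
        (Finset.image π (Finset.range m)).card = m ∧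
        MSP {s : Finset (Fin K) |
            -(c0 + ∑ k ∈ s, Δc k) ≤ τ0 + ∑ k ∈ s, δ k ∧
              τ0 + ∑ k ∈ s, δ k ≤ c0 + ∑ k ∈ s, Δc k} = (m : ℕ∞))) ∧
    ((¬ ∃ m, 1 ≤ m ∧ m ≤ Kp ∧ τ0 - c0 ≤ Esum e π m) →
      MSP {s : Finset (Fin K) |
          -(c0 + ∑ k ∈ s, Δc k) ≤ τ0 + ∑ k ∈ s, δ k ∧
            τ0 + ∑ k ∈ s, δ k ≤ c0 + ∑ k ∈ s, Δc k} = ⊤) := by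
  have hsum : ∀ s : Finset (Fin K), ∑ k ∈ s, e k = ∑ k ∈ s, Δc k - ∑ k ∈ s, δ k := fun s => by
    simp only [he, Finset.sum_sub_distrib]
  have hprefix : ∀ s : Finset (Fin K), τ0 + ∑ k ∈ s, δ k ≤ c0 + ∑ k ∈ s, Δc k →
      ∃ r, 1 ≤ r ∧ r ≤ s.card ∧ r ≤ Kp ∧ τ0 - c0 ≤ Esum e π r := by
    intro s hs
    obtain ⟨r, hrs, hrK, hr⟩ := exists_sum_le_Esum hπinj hπsurj hsort s
    have hle : τ0 - c0 ≤ Esum e π r := by linarith [hsum s]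
    refine ⟨r, Nat.one_le_iff_ne_zero.2 ?_, hrs, hrK, hle⟩
    rintro rfl
    simp only [Esum, Finset.range_zero, Finset.sum_empty] at hle
    linarith
  refine ⟨fun m _ hmK hm hmin hlow => ?_, fun hnone => ?_⟩
  · have hinj : Set.InjOn π (Finset.range m) := fun i hi j hj h =>
      hπinj i j ((Finset.mem_range.1 hi).trans_le hmK) ((Finset.mem_range.1 hj).trans_le hmK) h
    have hcard : (Finset.image π (Finset.range m)).card = m := by
      rw [Finset.card_image_of_injOn hinj, Finset.card_range]
    have hE : ∑ k ∈ Finset.image π (Finset.range m), e k = Esum e π m := Finset.sum_image hinj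
    have hmem : τ0 + ∑ k ∈ Finset.image π (Finset.range m), δ k ≤
        c0 + ∑ k ∈ Finset.image π (Finset.range m), Δc k := by
      linarith [hsum (Finset.image π (Finset.range m))]
    refine ⟨⟨hlow, hmem⟩, hcard, le_antisymm ?_ ?_⟩
    · exact (iInf₂_le _ ⟨hlow, hmem⟩).trans_eq (by rw [hcard])
    · refine le_iInf₂ fun s hs => ?_
      obtain ⟨r, hr1, hrs, _, hr⟩ := hprefix s hs.2
      have hmr : m ≤ r := not_lt.1 fun hlt => (hmin r hr1 hlt).not_ge hr
      exact_mod_cast hmr.trans hrs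
  · refine top_le_iff.1 (le_iInf₂ fun s hs => ?_)
    obtain ⟨r, hr1, _, hrK, hr⟩ := hprefix s hs.2
    exact absurd ⟨r, hr1, hrK, hr⟩ hnone
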